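/- arXiv:2302.10477 — 4 statements merged into one kernel-verified Lean document; each statement's English description precedes it below -/
import Mathlib

section
/- Let w, s ∈ D, let γ ∈ [0,1], and suppose s is a δ-approximate linear minimizer at w, i.e. ⟨s, ∇L(w)⟩ ≤ min_{ŝ ∈ D} ⟨ŝ, ∇L(w)⟩ + (1/2)·δ·γ·C_f for some accuracy δ ≥ 0. Then the step w' = w + γ(s − w) satisfies L(w') ≤ L(w) − γ·φ(w) + (γ²/2)·C_f·(1 + δ). -/
open scoped RealInnerProductSpace BigOperators

noncomputable section

/-- The standard simplex `D = {w ∈ ℝ^K : wᵢ ≥ 0, Σᵢ wᵢ = 1}`. -/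
def simplexD (K : ℕ) : Set (EuclideanSpace ℝ (Fin K)) :=
  {w | (∀ i, 0 ≤ w i) ∧ ∑ i, w i = 1}

/-- The surrogate duality gap `φ(w) = max_{s ∈ D} ⟨w − s, ∇L(w)⟩`. -/
def dualGap {K : ℕ} (gradL : EuclideanSpace ℝ (Fin K) → EuclideanSpace ℝ (Fin K))
    (w : EuclideanSpace ℝ (Fin K)) : ℝ :=
  sSup ((fun s => ⟪w - s, gradL w⟫) '' simplexD K)

theorem stmt0 {K : ℕ} (hK : 1 ≤ K)
    (L : EuclideanSpace ℝ (Fin K) → ℝ)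
    (gradL : EuclideanSpace ℝ (Fin K) → EuclideanSpace ℝ (Fin K))
    (hgrad : ∀ x, HasGradientAt L (gradL x) x)
    (Cf : ℝ) (hCf : 0 ≤ Cf)
    (hcurv : ∀ w ∈ simplexD K, ∀ s ∈ simplexD K, ∀ γ ∈ Set.Icc (0:ℝ) 1,
      L (w + γ • (s - w)) ≤ L w + γ * ⟪s - w, gradL w⟫ + γ ^ 2 / 2 * Cf)
    (w s : EuclideanSpace ℝ (Fin K)) (hw : w ∈ simplexD K) (hs : s ∈ simplexD K)
    (γ : ℝ) (hγ : γ ∈ Set.Icc (0:ℝ) 1)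
    (δ : ℝ) (hδ : 0 ≤ δ)
    (happrox : ⟪s, gradL w⟫ ≤
      sInf ((fun t => ⟪t, gradL w⟫) '' simplexD K) + 1 / 2 * δ * γ * Cf) :
    L (w + γ • (s - w)) ≤ L w - γ * dualGap gradL w + γ ^ 2 / 2 * Cf * (1 + δ) := by
  have hb : BddBelow ((fun t => ⟪t, gradL w⟫) '' simplexD K) := by
    refine ⟨-∑ i, |gradL w i|, ?_⟩
    rintro _ ⟨t, ht, rfl⟩
    have e : ⟪t, gradL w⟫ = ∑ i, t i * gradL w i := by
      simp [PiLp.inner_apply, mul_comm]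
    simp only [e]
    rw [← Finset.sum_neg_distrib]
    refine Finset.sum_le_sum fun i _ => ?_
    have h0 := ht.1 i
    have h1 : t i ≤ 1 := by
      rw [← ht.2]
      exact Finset.single_le_sum (f := fun j => t j) (fun j _ => ht.1 j) (Finset.mem_univ i)
    have h2 := neg_abs_le (gradL w i)
    have h3 := abs_nonneg (gradL w i)
    nlinarith [mul_le_mul_of_nonneg_left h2 h0, mul_le_mul_of_nonneg_right h1 h3]
  have hgap : dualGap gradL w ≤
      ⟪w, gradL w⟫ - sInf ((fun t => ⟪t, gradL w⟫) '' simplexD K) := by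
    refine csSup_le (Set.Nonempty.image _ ⟨w, hw⟩) ?_
    rintro _ ⟨t, ht, rfl⟩
    have := csInf_le hb ⟨t, ht, rfl⟩
    simp only [inner_sub_left] at this ⊢
    linarith
  have hc := hcurv w hw s hs γ hγ
  have hi : ⟪s - w, gradL w⟫ ≤ -dualGap gradL w + 1 / 2 * δ * γ * Cf := by
    rw [inner_sub_left]
    linarith
  have := mul_le_mul_of_nonneg_left hi hγ.1
  linarith
end
end

section
/- For every iteration index r ≥ 0, the Frank–Wolfe iterates satisfy the recursive primal-error bound ζ^(r+1) ≤ (1 − γ_r)·ζ^(r) + γ_r²·(C_f(1+δ)/2), where ζ^(r) = L(w^(r)) − L(w*) and γ_r = 2/(r+2). -/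
open scoped RealInnerProductSpace BigOperators

noncomputable section

theorem simplex_bdd {K : ℕ} (g : EuclideanSpace ℝ (Fin K)) :
    BddBelow ((fun t => ⟪t, g⟫) '' simplexD K) := by
  refine ⟨∑ i, -|g i|, ?_⟩
  rintro _ ⟨t, ht, rfl⟩
  simp only [PiLp.inner_apply]
  refine Finset.sum_le_sum fun i _ => ?_
  have h0 := ht.1 i
  have h1 : t i ≤ 1 := by
    rw [← ht.2]
    exact Finset.single_le_sum (f := fun i => t i) (fun j _ => ht.1 j) (Finset.mem_univ i)
  have h2 := neg_abs_le (g i)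
  have h3 := abs_nonneg (g i)
  simp only [RCLike.inner_apply, conj_trivial]
  nlinarith [mul_nonneg h0 (by linarith : 0 ≤ g i + |g i|), mul_nonneg h3 (by linarith : 0 ≤ 1 - t i)]

theorem simplex_step {K : ℕ} (a b : EuclideanSpace ℝ (Fin K)) (ha : a ∈ simplexD K)
    (hb : b ∈ simplexD K) (γ : ℝ) (h0 : 0 ≤ γ) (h1 : γ ≤ 1) :
    a + γ • (b - a) ∈ simplexD K := by
  constructor
  · intro i
    have := ha.1 i
    have := hb.1 i
    simp only [PiLp.add_apply, PiLp.smul_apply, PiLp.sub_apply, smul_eq_mul]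
    nlinarith [mul_nonneg h0 (hb.1 i), mul_nonneg (by linarith : 0 ≤ 1 - γ) (ha.1 i)]
  · simp only [PiLp.add_apply, PiLp.smul_apply, PiLp.sub_apply, smul_eq_mul]
    rw [Finset.sum_add_distrib, ← Finset.mul_sum, Finset.sum_sub_distrib, ha.2, hb.2]
    ring

theorem grad_ineq {K : ℕ} (L : EuclideanSpace ℝ (Fin K) → ℝ)
    (hconv : ConvexOn ℝ Set.univ L) (g x y : EuclideanSpace ℝ (Fin K))
    (hg : HasGradientAt L g x) : ⟪y - x, g⟫ ≤ L y - L x := by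
  have hc : ConvexOn ℝ Set.univ (L ∘ (AffineMap.lineMap x y : ℝ →ᵃ[ℝ] _)) := by
    simpa using hconv.comp_affineMap (AffineMap.lineMap x y : ℝ →ᵃ[ℝ] _)
  have hd : HasDerivAt (L ∘ (AffineMap.lineMap x y : ℝ →ᵃ[ℝ] _)) ⟪g, y - x⟫ 0 := by
    have h1 : HasDerivAt (fun t : ℝ => (AffineMap.lineMap x y : ℝ →ᵃ[ℝ] _) t) (y - x) 0 :=
      AffineMap.hasDerivAt_lineMap
    have h2 := hg.hasFDerivAt
    rw [← AffineMap.lineMap_apply_zero (k := ℝ) x y] at h2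
    have h3 := h2.comp_hasDerivAt (0:ℝ) h1
    simpa using h3
  have := hc.le_slope_of_hasDerivAt (Set.mem_univ 0) (Set.mem_univ 1) one_pos hd
  rw [real_inner_comm]
  simpa [slope_def_field] using this

theorem stmt2 {K : ℕ} (hK : 1 ≤ K)
    (L : EuclideanSpace ℝ (Fin K) → ℝ)
    (gradL : EuclideanSpace ℝ (Fin K) → EuclideanSpace ℝ (Fin K))
    (hgrad : ∀ x, HasGradientAt L (gradL x) x)
    (hconv : ConvexOn ℝ Set.univ L)
    (Cf : ℝ) (hCf : 0 ≤ Cf)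
    (hcurv : ∀ w ∈ simplexD K, ∀ s ∈ simplexD K, ∀ γ ∈ Set.Icc (0:ℝ) 1,
      L (w + γ • (s - w)) ≤ L w + γ * ⟪s - w, gradL w⟫ + γ ^ 2 / 2 * Cf)
    (wstar : EuclideanSpace ℝ (Fin K)) (hwstar : wstar ∈ simplexD K)
    (hmin : ∀ v ∈ simplexD K, L wstar ≤ L v)
    (δ : ℝ) (hδ : 0 ≤ δ)
    (w s : ℕ → EuclideanSpace ℝ (Fin K))
    (hw0 : w 0 ∈ simplexD K)
    (hsmem : ∀ r : ℕ, s r ∈ simplexD K)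
    (hstep : ∀ r : ℕ, w (r + 1) = w r + (2 / ((r : ℝ) + 2)) • (s r - w r))
    (happrox : ∀ r : ℕ, ⟪s r, gradL (w r)⟫ ≤
      sInf ((fun t => ⟪t, gradL (w r)⟫) '' simplexD K) + 1 / 2 * δ * (2 / ((r : ℝ) + 2)) * Cf)
    :
    ∀ r : ℕ, L (w (r + 1)) - L wstar ≤
      (1 - 2 / ((r : ℝ) + 2)) * (L (w r) - L wstar) +
        (2 / ((r : ℝ) + 2)) ^ 2 * (Cf * (1 + δ) / 2) := by
  have hγ0 : ∀ r : ℕ, 0 ≤ 2 / ((r : ℝ) + 2) := fun r => by positivity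
  have hγ1 : ∀ r : ℕ, 2 / ((r : ℝ) + 2) ≤ 1 := fun r => by
    rw [div_le_one (by positivity)]
    linarith [(Nat.cast_nonneg r : (0:ℝ) ≤ r)]
  have hmem : ∀ r, w r ∈ simplexD K := by
    intro r
    induction r with
    | zero => exact hw0
    | succ r ih => rw [hstep]; exact simplex_step _ _ ih (hsmem r) _ (hγ0 r) (hγ1 r)
  intro r
  have h1 := hcurv _ (hmem r) _ (hsmem r) _ ⟨hγ0 r, hγ1 r⟩
  rw [← hstep r] at h1
  have h2 := happrox r
  have h3 : sInf ((fun t => ⟪t, gradL (w r)⟫) '' simplexD K) ≤ ⟪wstar, gradL (w r)⟫ :=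
    csInf_le (simplex_bdd _) ⟨wstar, hwstar, rfl⟩
  have h4 := grad_ineq L hconv _ _ wstar (hgrad (w r))
  rw [inner_sub_left] at h1 h4
  have h0 := hγ0 r
  generalize 2 / ((r : ℝ) + 2) = γ at *
  have h5 := mul_le_mul_of_nonneg_left (show ⟪s r, gradL (w r)⟫ - ⟪w r, gradL (w r)⟫ ≤
    L wstar - L (w r) + 1 / 2 * δ * γ * Cf by linarith) h0
  nlinarith
end
end

section
/- Let C ≥ 0 and let (ζ_r)_{r ≥ 0} be a sequence of real numbers satisfying ζ_{r+1} ≤ (1 − 2/(r+2))·ζ_r + (2/(r+2))²·C for all r ≥ 0. Then ζ_{r+1} ≤ 4C/(r+3) for all r ≥ 0. -/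
theorem stmt3 (C : ℝ) (hC : 0 ≤ C) (ζ : ℕ → ℝ)
    (hrec : ∀ r : ℕ, ζ (r + 1) ≤ (1 - 2 / ((r : ℝ) + 2)) * ζ r + (2 / ((r : ℝ) + 2)) ^ 2 * C) :
    ∀ r : ℕ, ζ (r + 1) ≤ 4 * C / ((r : ℝ) + 3) := by
  intro r
  induction r with
  | zero =>
    have h := hrec 0
    norm_num at h ⊢
    linarith
  | succ k ih =>
    have h := hrec (k + 1)
    push_cast at h ⊢
    have hk : (0 : ℝ) ≤ k := Nat.cast_nonneg k
    have e : (k : ℝ) + 1 + 2 = k + 3 := by ring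
    rw [e] at h
    have hc : (0 : ℝ) ≤ 1 - 2 / ((k : ℝ) + 3) := by
      rw [sub_nonneg, div_le_one (by positivity)]
      linarith
    have h1 := mul_le_mul_of_nonneg_left ih hc
    have h2 : (1 - 2 / ((k : ℝ) + 3)) * (4 * C / ((k : ℝ) + 3)) + (2 / ((k : ℝ) + 3)) ^ 2 * C
        = 4 * C * (k + 2) / ((k : ℝ) + 3) ^ 2 := by
      field_simp
      ring
    have h3 : 4 * C * (k + 2) / ((k : ℝ) + 3) ^ 2 ≤ 4 * C / ((k : ℝ) + 1 + 3) := by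
      rw [div_le_div_iff₀ (by positivity) (by positivity)]
      nlinarith
    linarith
end

section
/- (Two-objective optimal weight, case 3 of equation (10).) If ⟨l₁, l₂⟩ < ‖l₁‖² and ⟨l₁, l₂⟩ < ‖l₂‖², then ‖l₁ − l₂‖² > 0, the weight w* = ⟨l₂ − l₁, l₂⟩ / ‖l₁ − l₂‖² lies in the open interval (0,1), and w* minimizes g(w) = ‖w·l₁ + (1−w)·l₂‖² over w ∈ [0,1]; that is, g(w*) ≤ g(w) for all w ∈ [0,1]. -/
open scoped RealInnerProductSpace

theorem stmt10 {n : ℕ} (l₁ l₂ : EuclideanSpace ℝ (Fin n))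
    (h1 : ⟪l₁, l₂⟫ < ‖l₁‖ ^ 2) (h2 : ⟪l₁, l₂⟫ < ‖l₂‖ ^ 2) :
    0 < ‖l₁ - l₂‖ ^ 2 ∧
    ⟪l₂ - l₁, l₂⟫ / ‖l₁ - l₂‖ ^ 2 ∈ Set.Ioo (0 : ℝ) 1 ∧
    ∀ w ∈ Set.Icc (0 : ℝ) 1,
      ‖(⟪l₂ - l₁, l₂⟫ / ‖l₁ - l₂‖ ^ 2) • l₁ + (1 - ⟪l₂ - l₁, l₂⟫ / ‖l₁ - l₂‖ ^ 2) • l₂‖ ^ 2 ≤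
        ‖w • l₁ + (1 - w) • l₂‖ ^ 2 := by
  have hD : ‖l₁ - l₂‖ ^ 2 = ‖l₁‖ ^ 2 - 2 * ⟪l₁, l₂⟫ + ‖l₂‖ ^ 2 := norm_sub_sq_real l₁ l₂
  have hN : ⟪l₂ - l₁, l₂⟫ = ‖l₂‖ ^ 2 - ⟪l₁, l₂⟫ := by
    rw [inner_sub_left, real_inner_self_eq_norm_sq]
  have hg : ∀ w : ℝ, ‖w • l₁ + (1 - w) • l₂‖ ^ 2 =
      w ^ 2 * ‖l₁‖ ^ 2 + 2 * (w * (1 - w) * ⟪l₁, l₂⟫) + (1 - w) ^ 2 * ‖l₂‖ ^ 2 := by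
    intro w
    rw [norm_add_sq_real, norm_smul, norm_smul, real_inner_smul_left, real_inner_smul_right,
      mul_pow, mul_pow, Real.norm_eq_abs, Real.norm_eq_abs, sq_abs, sq_abs]
    ring
  have hpos : 0 < ‖l₁ - l₂‖ ^ 2 := by rw [hD]; linarith
  refine ⟨hpos, ⟨div_pos (by rw [hN]; linarith) hpos, ?_⟩, ?_⟩
  · rw [div_lt_one hpos, hN, hD]; linarith
  · intro w _
    have hs : ⟪l₂ - l₁, l₂⟫ / ‖l₁ - l₂‖ ^ 2 * ‖l₁ - l₂‖ ^ 2 = ⟪l₂ - l₁, l₂⟫ :=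
      div_mul_cancel₀ _ hpos.ne'
    generalize ⟪l₂ - l₁, l₂⟫ / ‖l₁ - l₂‖ ^ 2 = s at hs ⊢
    rw [hg, hg]
    have h0 := mul_nonneg hpos.le (sq_nonneg (w - s))
    rw [hD, hN] at hs
    rw [hD] at h0
    linear_combination h0 + 2 * (s - w) * hs
end
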